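/- Given any quasisymmetric homeomorphism φ of ℝP¹, let w be the width of the convex hull of the graph gr(φ) in the boundary at infinity of three-dimensional Anti-de Sitter space. Then tanh(‖φ‖_cr / 4) ≤ tan(w). -/

import Mathlib

/-!
Common framework for formalizing "Maximal surfaces in Anti-de Sitter space, width of
convex hulls and quasiconformal extensions of quasisymmetric homeomorphisms" (A. Seppi).

Anti-de Sitter space is modeled projectively: `qform` is the bilinear form of
signature (2,2) on ℝ⁴, `AdS3` is the projectivization of its negative cone,
and spacelike surfaces are recorded through (lifts of) smooth spacelike embeddings
of ℝ² into the quadric {⟨x,x⟩ = -1} (the double cover of AdS³), together with a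
future-directed unit normal field and the associated shape operator.
-/

noncomputable section

open Real Set Filter Topology

namespace AdSPaper

/-- The bilinear form of signature `(2,2)` on `ℝ⁴`. -/
def qform (x y : Fin 4 → ℝ) : ℝ :=
  x 0 * y 0 + x 1 * y 1 - x 2 * y 2 - x 3 * y 3

/-- Quotient topology on a projectivization. -/
instance (K V : Type*) [DivisionRing K] [AddCommGroup V] [Module K V] [TopologicalSpace V] :
    TopologicalSpace (Projectivization K V) := by
  unfold Projectivization
  infer_instance

/-- Real projective 3-space. -/
abbrev RP3 := Projectivization ℝ (Fin 4 → ℝ)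

/-- The real projective line. -/
abbrev RP1 := Projectivization ℝ (Fin 2 → ℝ)

/-- The point of `ℝP³` determined by a nonzero vector of `ℝ⁴`. -/
def projPt (x : Fin 4 → ℝ) (hx : x ≠ 0) : RP3 := Projectivization.mk ℝ x hx

/-- Anti-de Sitter space: the projectivization of the negative cone of `qform`.
(The sign of `qform x x` does not depend on the chosen representative.) -/
def AdS3 : Set RP3 := {P | qform P.rep P.rep < 0}

/-- The boundary at infinity of Anti-de Sitter space: the projectivization of the null cone. -/
def bdryAdS3 : Set RP3 := {P | qform P.rep P.rep = 0}

/-- The nonzero lifts of a subset of `ℝP³`. -/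
def lifts (Γ : Set RP3) : Set (Fin 4 → ℝ) :=
  {x | ∃ hx : x ≠ 0, projPt x hx ∈ Γ}

/-- The (projective) convex hull of a set `Γ ⊆ ℝP³` contained in an affine chart:
the image of the convex hull of a coherent family of lifts of `Γ`, chosen on the positive
side of a linear hyperplane avoiding all lifts of `Γ` (i.e. an affine chart containing `Γ`). -/
def projConvexHull (Γ : Set RP3) : Set RP3 :=
  {P | ∃ L : (Fin 4 → ℝ) →ₗ[ℝ] ℝ, (∀ x ∈ lifts Γ, L x ≠ 0) ∧
      ∃ (y : Fin 4 → ℝ) (hy : y ≠ 0), projPt y hy = P ∧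
        y ∈ convexHull ℝ {x | x ∈ lifts Γ ∧ 0 < L x}}

/-- The width of (the convex hull of) a set `Γ ⊆ ℝP³`: the supremum of the lengths of
timelike geodesic segments `t ↦ [cos t • a + sin t • b]` contained in the convex hull of `Γ`. -/
def width (Γ : Set RP3) : ℝ :=
  sSup {T : ℝ | 0 ≤ T ∧ T < π ∧ ∃ a b : Fin 4 → ℝ,
      qform a a = -1 ∧ qform b b = -1 ∧ qform a b = 0 ∧
      ∀ t ∈ Icc (0 : ℝ) T, ∃ h : (Real.cos t • a + Real.sin t • b) ≠ 0,
        projPt (Real.cos t • a + Real.sin t • b) h ∈ projConvexHull Γ}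

/-- Inverse hyperbolic cosine. -/
def arcosh (x : ℝ) : ℝ := Real.log (x + Real.sqrt (x ^ 2 - 1))

/-! ### The projective line, cross-ratios and quasisymmetric homeomorphisms -/

/-- Determinant of a pair of vectors of ℝ². -/
def det2 (v w : Fin 2 → ℝ) : ℝ := v 0 * w 1 - v 1 * w 0

/-- The cross-ratio of a quadruple of points of `ℝP¹`, with the convention
`cr(z₁,z₂,z₃,z₄) = (z₄−z₁)(z₃−z₂)/((z₂−z₁)(z₃−z₄))`.  (The expression below is
invariant under rescaling of each of the four representatives.) -/
def crossRatio (z₁ z₂ z₃ z₄ : RP1) : ℝ :=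
  (det2 z₄.rep z₁.rep * det2 z₃.rep z₂.rep) / (det2 z₂.rep z₁.rep * det2 z₃.rep z₄.rep)

/-- The cyclic orientation invariant of a triple of points of `ℝP¹`
(for finite points `a,b,c` it equals `(a−b)(b−c)(c−a)` and its sign is scale invariant). -/
def tripleOrient (a b c : RP1) : ℝ :=
  det2 a.rep b.rep * det2 b.rep c.rep * det2 c.rep a.rep

/-- A map of `ℝP¹` is orientation-preserving if it preserves the cyclic orientation
of triples of points. -/
def OrientationPreserving (φ : RP1 → RP1) : Prop :=
  ∀ a b c : RP1, 0 < tripleOrient a b c → 0 < tripleOrient (φ a) (φ b) (φ c)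

/-- The set of cross-ratio distortions `|ln |cr(φ(Q))||` of symmetric quadruples
(`cr(Q) = -1`) under the map `φ`. -/
def crSet (φ : RP1 → RP1) : Set ℝ :=
  {r | ∃ z₁ z₂ z₃ z₄ : RP1, crossRatio z₁ z₂ z₃ z₄ = -1 ∧
      r = |Real.log (abs (crossRatio (φ z₁) (φ z₂) (φ z₃) (φ z₄)))|}

/-- The cross-ratio norm `‖φ‖_cr` of a circle map `φ`. -/
def crNorm (φ : RP1 → RP1) : ℝ := sSup (crSet φ)

/-- A quasisymmetric homeomorphism of `ℝP¹`: an orientation-preserving homeomorphism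
with finite cross-ratio norm. -/
def Quasisymmetric (φ : RP1 ≃ₜ RP1) : Prop :=
  OrientationPreserving ⇑φ ∧ BddAbove (crSet ⇑φ)

/-- The null vector of ℝ^{2,2} corresponding to the pair of lines `([v],[w]) ∈ ℝP¹ × ℝP¹`
under the standard identification of `∂∞AdS³` with `ℝP¹ × ℝP¹` (via the rank-one
2×2 matrix `v wᵀ`, identifying ℝ^{2,2} with 2×2 matrices with minus the determinant). -/
def toBoundary (v w : Fin 2 → ℝ) : Fin 4 → ℝ :=
  ![(v 0 * w 0 - v 1 * w 1) / 2, (v 0 * w 1 + v 1 * w 0) / 2,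
    (v 0 * w 0 + v 1 * w 1) / 2, (v 0 * w 1 - v 1 * w 0) / 2]

/-- The graph `gr(φ)` of a map `φ : ℝP¹ → ℝP¹`, as a curve in `∂∞AdS³ ⊆ ℝP³`. -/
def grGraph (φ : RP1 → RP1) : Set RP3 :=
  {P | ∃ (v w : Fin 2 → ℝ) (hv : v ≠ 0) (hw : w ≠ 0) (hx : toBoundary v w ≠ 0),
      projPt (toBoundary v w) hx = P ∧
      φ (Projectivization.mk ℝ v hv) = Projectivization.mk ℝ w hw}

/-! ### Spacelike and maximal surfaces in AdS³ -/

/-- The global timelike vector field `x ↦ (0,0,−x₄,x₃)` on the quadric, fixing the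
time orientation of AdS³. -/
def timeVec (x : Fin 4 → ℝ) : Fin 4 → ℝ := ![0, 0, -(x 3), x 2]

/-- A (lifted, parametrized) smooth spacelike embedded disc in AdS³: a smooth embedding
of ℝ² into the quadric `{⟨x,x⟩ = −1} ⊆ ℝ^{2,2}` (the double cover of AdS³), with spacelike
first fundamental form, together with its future-directed unit normal field and
the associated shape operator `B = ∇N`. -/
structure SpacelikeSurface where
  /-- the embedding of ℝ² into the quadric -/
  emb : (Fin 2 → ℝ) → (Fin 4 → ℝ)
  /-- the future-directed unit normal vector field -/
  normal : (Fin 2 → ℝ) → (Fin 4 → ℝ)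
  /-- the shape operator, in the coordinates of the parametrization -/
  shape : (Fin 2 → ℝ) → ((Fin 2 → ℝ) →ₗ[ℝ] (Fin 2 → ℝ))
  smooth_emb : ContDiff ℝ (⊤ : ℕ∞) emb
  smooth_normal : ContDiff ℝ (⊤ : ℕ∞) normal
  inj : Function.Injective emb
  on_quadric : ∀ y, qform (emb y) (emb y) = -1
  spacelike : ∀ y v, v ≠ 0 → 0 < qform (fderiv ℝ emb y v) (fderiv ℝ emb y v)
  normal_unit : ∀ y, qform (normal y) (normal y) = -1
  normal_orth_base : ∀ y, qform (normal y) (emb y) = 0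
  normal_orth : ∀ y v, qform (normal y) (fderiv ℝ emb y v) = 0
  normal_future : ∀ y, qform (normal y) (timeVec (emb y)) < 0
  shape_spec : ∀ y v, fderiv ℝ normal y v = fderiv ℝ emb y (shape y v)

namespace SpacelikeSurface

variable (S : SpacelikeSurface)

/-- A spacelike surface is maximal if its shape operator is traceless. -/
def IsMaximal : Prop := ∀ y, LinearMap.trace ℝ (Fin 2 → ℝ) (S.shape y) = 0

/-- The surface as a subset of `ℝP³` (i.e. of AdS³). -/
def proj : Set RP3 :=
  {P | ∃ (y : Fin 2 → ℝ) (h : S.emb y ≠ 0), projPt (S.emb y) h = P}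

/-- The asymptotic boundary `∂∞S` of the surface: the frontier `closure S \ S`. -/
def bdryAtInfinity : Set RP3 := closure S.proj \ S.proj

/-- The surface is entire if its frontier is contained in the boundary at
infinity of AdS³. -/
def IsEntire : Prop := S.bdryAtInfinity ⊆ bdryAdS3

/-- The nonnegative principal curvature `λ` at a point: for a maximal surface the
principal curvatures are `±λ` with `λ = √(−det B)`. -/
def lambdaAt (y : Fin 2 → ℝ) : ℝ := Real.sqrt (-(LinearMap.det (S.shape y)))

/-- The supremum `‖λ‖∞` of the principal curvatures of the surface. -/
def lambdaSup : ℝ := ⨆ y, S.lambdaAt y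

/-- Nonpositive curvature: by the Gauss equation `K = −1 + λ²`, this is `λ ≤ 1`. -/
def NonpositiveCurvature : Prop := ∀ y, S.lambdaAt y ≤ 1

/-- Uniformly negative curvature: `λ ≤ 1 − ε` for some `ε > 0`. -/
def UniformlyNegativeCurvature : Prop := ∃ ε > 0, ∀ y, S.lambdaAt y ≤ 1 - ε

/-- The set of non-umbilical points of a maximal surface (where `λ ≠ 0`). -/
def nonUmbilic : Set (Fin 2 → ℝ) := {y | LinearMap.det (S.shape y) ≠ 0}

/-- The intrinsic distance of the induced Riemannian metric on the surface. -/
def idist (y₁ y₂ : Fin 2 → ℝ) : ℝ :=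
  sInf {L | ∃ c : ℝ → (Fin 2 → ℝ), ContDiff ℝ (⊤ : ℕ∞) c ∧ c 0 = y₁ ∧ c 1 = y₂ ∧
      L = ∫ t in (0:ℝ)..(1:ℝ),
        Real.sqrt (qform (deriv (fun s => S.emb (c s)) t) (deriv (fun s => S.emb (c s)) t))}

/-- `F` is the intrinsic gradient field of the function `f` on `U ⊆ S`: the vector field
which is `I`-dual to the differential of `f`. -/
def IsGradientOn (U : Set (Fin 2 → ℝ)) (f : (Fin 2 → ℝ) → ℝ)
    (F : (Fin 2 → ℝ) → (Fin 2 → ℝ)) : Prop :=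
  ∀ y ∈ U, ∀ v, qform (fderiv ℝ S.emb y (F y)) (fderiv ℝ S.emb y v) = fderiv ℝ f y v

/-- `H` is the intrinsic Hessian (as a (1,1)-tensor) of a function with gradient field `F`
on `U ⊆ S`: the tangential part of the ambient flat derivative of the ambient gradient
field (the normal part, in the ambient coordinates, lies in `span{σ(y), N(y)}`). -/
def IsHessianOn (U : Set (Fin 2 → ℝ)) (F : (Fin 2 → ℝ) → (Fin 2 → ℝ))
    (H : (Fin 2 → ℝ) → ((Fin 2 → ℝ) →ₗ[ℝ] (Fin 2 → ℝ))) : Prop :=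
  ∀ y ∈ U, ∀ v, ∃ a b : ℝ,
    fderiv ℝ (fun y' => fderiv ℝ S.emb y' (F y')) y v
      = fderiv ℝ S.emb y (H y v) + a • S.emb y + b • S.normal y

/-- The squared norm `‖grad f‖²` of a gradient field `F`, for the induced metric. -/
def gradNormSq (F : (Fin 2 → ℝ) → (Fin 2 → ℝ)) (y : Fin 2 → ℝ) : ℝ :=
  qform (fderiv ℝ S.emb y (F y)) (fderiv ℝ S.emb y (F y))

/-- `Δf` is the Laplace–Beltrami operator of the induced metric applied to `f`, on `U`:
the trace of the intrinsic Hessian. -/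
def IsLaplacianOn (U : Set (Fin 2 → ℝ)) (f Δf : (Fin 2 → ℝ) → ℝ) : Prop :=
  ∃ F H, S.IsGradientOn U f F ∧ S.IsHessianOn U F H ∧
    ∀ y ∈ U, Δf y = LinearMap.trace ℝ (Fin 2 → ℝ) (H y)

/-- `c` parametrizes an intrinsic geodesic of the surface: the ambient acceleration
is orthogonal to the surface, i.e. lies in `span{σ(c t), N(c t)}`. -/
def IsIntrinsicGeodesic (c : ℝ → (Fin 2 → ℝ)) : Prop :=
  ∀ t, ∃ a b : ℝ,
    deriv (deriv (fun s => S.emb (c s))) t = a • S.emb (c t) + b • S.normal (c t)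

/-- `E` is a system of normal coordinates for the surface centered at `y₀` (i.e. the
exponential map of the induced metric at that point, read in an orthonormal frame). -/
def IsNormalCoordsAt (y₀ : Fin 2 → ℝ) (E : (Fin 2 → ℝ) → (Fin 2 → ℝ)) : Prop :=
  E 0 = y₀ ∧ (∀ v, S.IsIntrinsicGeodesic (fun t => E (t • v))) ∧
  ∀ v w : Fin 2 → ℝ,
    qform (deriv (fun t : ℝ => S.emb (E (t • v))) 0) (deriv (fun t : ℝ => S.emb (E (t • w))) 0)
      = v 0 * w 0 + v 1 * w 1

end SpacelikeSurface

/-- The normal flow at time `ρ`: the parametrization of the surface `S_ρ` at constant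
timelike distance `ρ` from `S`. -/
def parallelEmb (S : SpacelikeSurface) (ρ : ℝ) : (Fin 2 → ℝ) → (Fin 4 → ℝ) :=
  fun y => Real.cos ρ • S.emb y + Real.sin ρ • S.normal y

/-- The pull-back to `S` of the first fundamental form of the parallel surface `S_ρ`. -/
def Irho (S : SpacelikeSurface) (ρ : ℝ) (y : Fin 2 → ℝ) (v w : Fin 2 → ℝ) : ℝ :=
  qform (fderiv ℝ (parallelEmb S ρ) y v) (fderiv ℝ (parallelEmb S ρ) y w)

/-- The second fundamental form of the parallel surface `S_ρ`, via `II_ρ = ½ dI_ρ/dρ`. -/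
def IIrho (S : SpacelikeSurface) (ρ : ℝ) (y : Fin 2 → ℝ) (v w : Fin 2 → ℝ) : ℝ :=
  (1 / 2) * deriv (fun ρ' => Irho S ρ' y v w) ρ

/-! ### Euclidean balls and `C⁰`/`C²` norms on ℝ² -/

/-- The Euclidean ball of radius `r` centered at the origin of ℝ². -/
def eball (r : ℝ) : Set (Fin 2 → ℝ) := {z | Real.sqrt ((z 0) ^ 2 + (z 1) ^ 2) < r}

/-- The `C⁰` norm of a function on the Euclidean ball of radius `r`. -/
def C0norm (u : (Fin 2 → ℝ) → ℝ) (r : ℝ) : ℝ :=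
  sSup {a | ∃ z ∈ eball r, a = |u z|}

/-- The `C²` norm of a function on the Euclidean ball of radius `r`. -/
def C2norm (u : (Fin 2 → ℝ) → ℝ) (r : ℝ) : ℝ :=
  sSup {a | ∃ z ∈ eball r, a = |u z| + ‖fderiv ℝ u z‖ + ‖fderiv ℝ (fderiv ℝ u) z‖}

end AdSPaper

namespace AdSPaper

/-! ### Bilinear algebra -/

lemma qform_add_left (x y z : Fin 4 → ℝ) : qform (x + y) z = qform x z + qform y z := by
  simp [qform]; ring

lemma qform_add_right (x y z : Fin 4 → ℝ) : qform x (y + z) = qform x y + qform x z := by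
  simp [qform]; ring

lemma qform_smul_left (c : ℝ) (x y : Fin 4 → ℝ) : qform (c • x) y = c * qform x y := by
  simp [qform]; ring

lemma qform_smul_right (c : ℝ) (x y : Fin 4 → ℝ) : qform x (c • y) = c * qform x y := by
  simp [qform]; ring

lemma qform_comm (x y : Fin 4 → ℝ) : qform x y = qform y x := by
  simp [qform]; ring

/-- The form `qform` with its first argument fixed, as a linear functional. -/
def qformLinear (x : Fin 4 → ℝ) : (Fin 4 → ℝ) →ₗ[ℝ] ℝ where
  toFun := qform x
  map_add' := qform_add_right x
  map_smul' c y := qform_smul_right c x y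

lemma det2_self (v : Fin 2 → ℝ) : det2 v v = 0 := by simp [det2]; ring

lemma det2_swap (v w : Fin 2 → ℝ) : det2 v w = -det2 w v := by simp [det2]; ring

lemma det2_add_left (u v w : Fin 2 → ℝ) : det2 (u + v) w = det2 u w + det2 v w := by
  simp [det2]; ring

lemma det2_add_right (u v w : Fin 2 → ℝ) : det2 u (v + w) = det2 u v + det2 u w := by
  simp [det2]; ring

lemma det2_smul_left (c : ℝ) (v w : Fin 2 → ℝ) : det2 (c • v) w = c * det2 v w := by
  simp [det2]; ring

lemma det2_smul_right (c : ℝ) (v w : Fin 2 → ℝ) : det2 v (c • w) = c * det2 v w := by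
  simp [det2]; ring

lemma qform_toBoundary (a b c d : Fin 2 → ℝ) :
    qform (toBoundary a b) (toBoundary c d) = -(1 / 2) * (det2 a c * det2 b d) := by
  simp [qform, toBoundary, det2]; ring

lemma toBoundary_add_left (a b c : Fin 2 → ℝ) :
    toBoundary (a + b) c = toBoundary a c + toBoundary b c := by
  ext i; fin_cases i <;> simp [toBoundary] <;> ring

lemma toBoundary_add_right (a b c : Fin 2 → ℝ) :
    toBoundary a (b + c) = toBoundary a b + toBoundary a c := by
  ext i; fin_cases i <;> simp [toBoundary] <;> ring

lemma toBoundary_smul_left (t : ℝ) (a b : Fin 2 → ℝ) :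
    toBoundary (t • a) b = t • toBoundary a b := by
  ext i; fin_cases i <;> simp [toBoundary] <;> ring

lemma toBoundary_smul_right (t : ℝ) (a b : Fin 2 → ℝ) :
    toBoundary a (t • b) = t • toBoundary a b := by
  ext i; fin_cases i <;> simp [toBoundary] <;> ring

/-- Expansion of a vector of the plane in a basis of determinant one. -/
lemma eq_smul_add_smul_of_det2_eq_one {v u : Fin 2 → ℝ} (h : det2 v u = 1) (x : Fin 2 → ℝ) :
    x = det2 v x • u + det2 x u • v := by
  simp only [det2] at h
  ext i
  fin_cases i
  · simp [det2]; linear_combination -(x 0) * h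
  · simp [det2]; linear_combination -(x 1) * h

lemma ne_zero_of_det2_right {v w : Fin 2 → ℝ} (h : det2 v w ≠ 0) : w ≠ 0 := by
  rintro rfl; simp [det2] at h

lemma exists_det2_eq_one {v : Fin 2 → ℝ} (hv : v ≠ 0) : ∃ u, det2 v u = 1 := by
  have hn : v 0 ^ 2 + v 1 ^ 2 ≠ 0 := by
    intro h
    apply hv
    ext i
    fin_cases i
    · simp; nlinarith [sq_nonneg (v 0), sq_nonneg (v 1)]
    · simp; nlinarith [sq_nonneg (v 0), sq_nonneg (v 1)]
  refine ⟨![-(v 1) / (v 0 ^ 2 + v 1 ^ 2), v 0 / (v 0 ^ 2 + v 1 ^ 2)], ?_⟩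
  simp [det2]
  field_simp
  ring

lemma toBoundary_ne_zero {v w : Fin 2 → ℝ} (hv : v ≠ 0) (hw : w ≠ 0) : toBoundary v w ≠ 0 := by
  obtain ⟨u, hu⟩ := exists_det2_eq_one hv
  obtain ⟨x, hx⟩ := exists_det2_eq_one hw
  intro h
  have := qform_toBoundary v w u x
  rw [h, hu, hx] at this
  norm_num [qform] at this

/-! ### Points of the projective line -/

lemma exists_rep_mk_eq_smul {v : Fin 2 → ℝ} (hv : v ≠ 0) :
    ∃ a : ℝ, a ≠ 0 ∧ (Projectivization.mk ℝ v hv).rep = a • v := by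
  obtain ⟨a, ha⟩ := Projectivization.exists_smul_eq_mk_rep ℝ v hv
  exact ⟨a, a.ne_zero, ha.symm⟩

lemma mk_eq_mk_iff_det2 {v w : Fin 2 → ℝ} (hv : v ≠ 0) (hw : w ≠ 0) :
    Projectivization.mk ℝ v hv = Projectivization.mk ℝ w hw ↔ det2 v w = 0 := by
  rw [Projectivization.mk_eq_mk_iff']
  constructor
  · rintro ⟨a, rfl⟩
    rw [det2_smul_left, det2_self, mul_zero]
  · intro h
    obtain ⟨u, hu⟩ := exists_det2_eq_one hw
    refine ⟨det2 v u, ?_⟩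
    have := eq_smul_add_smul_of_det2_eq_one hu v
    rw [det2_swap w v, h] at this
    simpa using this.symm

lemma tripleOrient_mk_pos_iff {a b c : Fin 2 → ℝ} (ha : a ≠ 0) (hb : b ≠ 0) (hc : c ≠ 0) :
    0 < tripleOrient (.mk ℝ a ha) (.mk ℝ b hb) (.mk ℝ c hc) ↔
      0 < det2 a b * det2 b c * det2 c a := by
  obtain ⟨x, hx, ex⟩ := exists_rep_mk_eq_smul ha
  obtain ⟨y, hy, ey⟩ := exists_rep_mk_eq_smul hb
  obtain ⟨z, hz, ez⟩ := exists_rep_mk_eq_smul hc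
  have : tripleOrient (.mk ℝ a ha) (.mk ℝ b hb) (.mk ℝ c hc)
      = (x * y * z) ^ 2 * (det2 a b * det2 b c * det2 c a) := by
    rw [tripleOrient, ex, ey, ez]
    simp only [det2_smul_left, det2_smul_right]
    ring
  rw [this]
  exact mul_pos_iff_of_pos_left (by positivity)

lemma crossRatio_mk {a b c d : Fin 2 → ℝ} (ha : a ≠ 0) (hb : b ≠ 0) (hc : c ≠ 0) (hd : d ≠ 0) :
    crossRatio (.mk ℝ a ha) (.mk ℝ b hb) (.mk ℝ c hc) (.mk ℝ d hd) =
      (det2 d a * det2 c b) / (det2 b a * det2 c d) := by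
  obtain ⟨x, hx, ex⟩ := exists_rep_mk_eq_smul ha
  obtain ⟨y, hy, ey⟩ := exists_rep_mk_eq_smul hb
  obtain ⟨z, hz, ez⟩ := exists_rep_mk_eq_smul hc
  obtain ⟨t, ht, et⟩ := exists_rep_mk_eq_smul hd
  rw [crossRatio, ex, ey, ez, et]
  simp only [det2_smul_left, det2_smul_right]
  rw [← mul_div_mul_left (det2 d a * det2 c b) (det2 b a * det2 c d)
    (show x * y * z * t ≠ 0 by positivity)]
  congr 1 <;> ring

/-! ### The graph of a circle map in an adapted affine chart -/

/-- The nonzero vectors `v`, `w` span lines corresponding to each other under `φ`. -/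
def OnGraph (φ : RP1 → RP1) (v w : Fin 2 → ℝ) : Prop :=
  ∃ (hv : v ≠ 0) (hw : w ≠ 0), φ (.mk ℝ v hv) = .mk ℝ w hw

lemma OnGraph.smul {φ : RP1 → RP1} {v w : Fin 2 → ℝ} (h : OnGraph φ v w) {a b : ℝ}
    (ha : a ≠ 0) (hb : b ≠ 0) : OnGraph φ (a • v) (b • w) := by
  obtain ⟨hv, hw, e⟩ := h
  refine ⟨smul_ne_zero ha hv, smul_ne_zero hb hw, ?_⟩
  have e₁ : Projectivization.mk ℝ (a • v) (smul_ne_zero ha hv) = .mk ℝ v hv := by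
    rw [mk_eq_mk_iff_det2, det2_smul_left, det2_self, mul_zero]
  have e₂ : Projectivization.mk ℝ (b • w) (smul_ne_zero hb hw) = .mk ℝ w hw := by
    rw [mk_eq_mk_iff_det2, det2_smul_left, det2_self, mul_zero]
  rw [e₁, e₂, e]

lemma OnGraph.det2_eq_zero {φ : RP1 → RP1} {v v' w w' : Fin 2 → ℝ} (h : OnGraph φ v w)
    (h' : OnGraph φ v' w') (hd : det2 v v' = 0) : det2 w w' = 0 := by
  obtain ⟨hv, hw, e⟩ := h
  obtain ⟨hv', hw', e'⟩ := h'
  rw [← mk_eq_mk_iff_det2 hv hv'] at hd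
  rw [← mk_eq_mk_iff_det2 hw hw', ← e, ← e', hd]

lemma exists_onGraph (φ : RP1 → RP1) {v : Fin 2 → ℝ} (hv : v ≠ 0) : ∃ w, OnGraph φ v w :=
  ⟨(φ (.mk ℝ v hv)).rep, hv, Projectivization.rep_nonzero _, (Projectivization.mk_rep _).symm⟩

lemma mem_lifts_grGraph_iff {φ : RP1 → RP1} {x : Fin 4 → ℝ} :
    x ∈ lifts (grGraph φ) ↔ ∃ v w, OnGraph φ v w ∧ x = toBoundary v w := by
  constructor
  · rintro ⟨hx, v, w, hv, hw, hvw, e, he⟩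
    obtain ⟨a, rfl⟩ := (Projectivization.mk_eq_mk_iff' ℝ _ _ _ _).1 e.symm
    have ha : a ≠ 0 := by rintro rfl; simp at hx
    refine ⟨a • v, w, ?_, (toBoundary_smul_left a v w).symm⟩
    have h : OnGraph φ v w := ⟨hv, hw, he⟩
    simpa using h.smul ha one_ne_zero
  · rintro ⟨v, w, ⟨hv, hw, e⟩, rfl⟩
    exact ⟨toBoundary_ne_zero hv hw, v, w, hv, hw, toBoundary_ne_zero hv hw, rfl, e⟩

/-- In the bases `(v, u)` and `(w, x)` of determinant one, the circle map `φ` sends the point at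
infinity `[v]` to `[w]` and acts on the remaining points as the increasing bijection `r`. -/
structure GraphChart (φ : RP1 → RP1) (v u w x : Fin 2 → ℝ) (r : ℝ → ℝ) : Prop where
  det_dom : det2 v u = 1
  det_cod : det2 w x = 1
  infinite : OnGraph φ v w
  finite : ∀ s, OnGraph φ (u + s • v) (x + r s • w)
  strictMono : StrictMono r
  surjective : Function.Surjective r

section Chart

variable {v u w x : Fin 2 → ℝ}

lemma det2_infinite_finite (h : det2 v u = 1) (s : ℝ) : det2 v (u + s • v) = 1 := by
  rw [det2_add_right, det2_smul_right, det2_self, h]; ring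

lemma det2_finite_finite (h : det2 v u = 1) (s t : ℝ) :
    det2 (u + s • v) (u + t • v) = s - t := by
  have h' : det2 u v = -1 := by rw [det2_swap, h]
  simp only [det2_add_left, det2_add_right, det2_smul_left, det2_smul_right, det2_self, h, h']
  ring

lemma crossRatio_chart (h : det2 v u = 1) {a b c : ℝ} (hv : v ≠ 0) (ha : u + a • v ≠ 0)
    (hb : u + b • v ≠ 0) (hc : u + c • v ≠ 0) :
    crossRatio (.mk ℝ v hv) (.mk ℝ _ ha) (.mk ℝ _ hb) (.mk ℝ _ hc) = (b - a) / (b - c) := by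
  rw [crossRatio_mk, det2_swap _ v, det2_swap _ v, det2_finite_finite h, det2_finite_finite h,
    det2_infinite_finite h, det2_infinite_finite h, mul_div_mul_left _ _ (by norm_num)]

lemma exists_eq_smul_finite (h : det2 v u = 1) {y : Fin 2 → ℝ} (hy : det2 v y ≠ 0) :
    ∃ c s : ℝ, c ≠ 0 ∧ y = c • (u + s • v) := by
  refine ⟨det2 v y, det2 y u / det2 v y, hy, ?_⟩
  rw [smul_add, smul_smul, mul_div_cancel₀ _ hy]
  exact eq_smul_add_smul_of_det2_eq_one h y

lemma exists_eq_smul_infinite (h : det2 v u = 1) {y : Fin 2 → ℝ} (hy : y ≠ 0)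
    (h0 : det2 v y = 0) : ∃ c : ℝ, c ≠ 0 ∧ y = c • v := by
  have e := eq_smul_add_smul_of_det2_eq_one h y
  rw [h0, zero_smul, zero_add] at e
  refine ⟨det2 y u, ?_, e⟩
  intro hc
  rw [hc, zero_smul] at e
  exact hy e

lemma exists_graphChart {φ : RP1 → RP1} (hbij : Function.Bijective φ)
    (hor : OrientationPreserving φ) (hvu : det2 v u = 1) (hwx : det2 w x = 1)
    (hvw : OnGraph φ v w) : ∃ r, GraphChart φ v u w x r := by
  have hfin : ∀ s : ℝ, ∃ y : ℝ, OnGraph φ (u + s • v) (x + y • w) := by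
    intro s
    have hd := det2_infinite_finite hvu s
    obtain ⟨w', hg⟩ := exists_onGraph φ (ne_zero_of_det2_right (v := v) (by rw [hd]; simp))
    have hw' : det2 w w' ≠ 0 := by
      obtain ⟨hv, hw, e⟩ := hvw
      obtain ⟨hv', hw', e'⟩ := hg
      intro h0
      rw [← mk_eq_mk_iff_det2 hw hw', ← e, ← e'] at h0
      have := (mk_eq_mk_iff_det2 hv hv').1 (hbij.1 h0)
      rw [hd] at this
      exact one_ne_zero this
    obtain ⟨c, y, hc, rfl⟩ := exists_eq_smul_finite hwx hw'
    refine ⟨y, ?_⟩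
    have := hg.smul one_ne_zero (inv_ne_zero hc)
    rwa [one_smul, inv_smul_smul₀ hc] at this
  choose r hr using hfin
  refine ⟨r, hvu, hwx, hvw, hr, ?_, ?_⟩
  · intro s t hst
    obtain ⟨hv, hw, e⟩ := hvw
    obtain ⟨hs, hs', es⟩ := hr s
    obtain ⟨ht, ht', et⟩ := hr t
    have := hor (.mk ℝ v hv) (.mk ℝ _ hs) (.mk ℝ _ ht)
    rw [e, es, et, tripleOrient_mk_pos_iff, tripleOrient_mk_pos_iff,
      det2_infinite_finite hvu, det2_infinite_finite hwx, det2_finite_finite hvu,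
      det2_finite_finite hwx, det2_swap _ v, det2_swap _ w, det2_infinite_finite hvu,
      det2_infinite_finite hwx] at this
    linarith [this (by linarith)]
  · intro y
    have hne : x + y • w ≠ 0 :=
      ne_zero_of_det2_right (v := w) (by rw [det2_infinite_finite hwx]; simp)
    obtain ⟨p, hp⟩ := hbij.2 (.mk ℝ _ hne)
    induction p using Projectivization.ind with | h y' hy' =>
    have hg : OnGraph φ y' (x + y • w) := ⟨hy', hne, hp⟩
    have hd : det2 v y' ≠ 0 := by
      intro h0
      have := hvw.det2_eq_zero hg h0
      rw [det2_infinite_finite hwx] at this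
      exact one_ne_zero this
    obtain ⟨c, s, hc, rfl⟩ := exists_eq_smul_finite hvu hd
    refine ⟨s, ?_⟩
    have := (hr s).det2_eq_zero hg (by rw [det2_smul_right, det2_self, mul_zero])
    rw [det2_finite_finite hwx] at this
    linarith

variable {φ : RP1 → RP1} {r : ℝ → ℝ}

lemma GraphChart.cases (C : GraphChart φ v u w x r) {y z : Fin 2 → ℝ} (h : OnGraph φ y z) :
    ∃ c d : ℝ, c ≠ 0 ∧ d ≠ 0 ∧
      ((y = c • v ∧ z = d • w) ∨ ∃ s, y = c • (u + s • v) ∧ z = d • (x + r s • w)) := by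
  obtain ⟨hy, hz, -⟩ := id h
  by_cases h0 : det2 v y = 0
  · have h1 := C.infinite.det2_eq_zero h h0
    obtain ⟨c, hc, rfl⟩ := exists_eq_smul_infinite C.det_dom hy h0
    obtain ⟨d, hd, rfl⟩ := exists_eq_smul_infinite C.det_cod hz h1
    exact ⟨c, d, hc, hd, .inl ⟨rfl, rfl⟩⟩
  · obtain ⟨c, s, hc, rfl⟩ := exists_eq_smul_finite C.det_dom h0
    have h1 := (C.finite s).det2_eq_zero h (by rw [det2_smul_right, det2_self, mul_zero])
    have hx' : det2 (x + r s • w) (-w) = 1 := by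
      rw [← neg_one_smul ℝ w, det2_smul_right, det2_swap, det2_infinite_finite C.det_cod]; ring
    obtain ⟨d, hd, rfl⟩ := exists_eq_smul_infinite hx' hz h1
    exact ⟨c, d, hc, hd, .inr ⟨s, rfl, rfl⟩⟩

/-- In the chart, bounded cross-ratio distortion is the `M`-condition of Beurling–Ahlfors. -/
lemma GraphChart.symmetric_ratio_le (C : GraphChart φ v u w x r) {N : ℝ}
    (hN : N ∈ upperBounds (crSet φ)) (s : ℝ) {h : ℝ} (hh : 0 < h) :
    r (s + h) - r s ≤ exp N * (r s - r (s - h)) ∧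
      r s - r (s - h) ≤ exp N * (r (s + h) - r s) := by
  obtain ⟨h1, k1, e1⟩ := C.infinite
  obtain ⟨h2, k2, e2⟩ := C.finite (s - h)
  obtain ⟨h3, k3, e3⟩ := C.finite s
  obtain ⟨h4, k4, e4⟩ := C.finite (s + h)
  have p1 : 0 < r (s + h) - r s := sub_pos.2 (C.strictMono (by linarith))
  have p2 : 0 < r s - r (s - h) := sub_pos.2 (C.strictMono (by linarith))
  have hcr : crossRatio (.mk ℝ _ h1) (.mk ℝ _ h2) (.mk ℝ _ h3) (.mk ℝ _ h4) = -1 := by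
    rw [crossRatio_chart C.det_dom, sub_sub_cancel, sub_add_cancel_left, div_neg,
      div_self hh.ne']
  have := hN ⟨_, _, _, _, hcr, rfl⟩
  rw [e1, e2, e3, e4, crossRatio_chart C.det_cod, abs_div, abs_of_pos p2,
    abs_sub_comm (r s) (r (s + h)), abs_of_pos p1, Real.log_div p2.ne' p1.ne', abs_le] at this
  constructor
  · rw [← Real.log_le_log_iff p1 (by positivity), Real.log_mul (by positivity) p2.ne',
      Real.log_exp]
    linarith
  · rw [← Real.log_le_log_iff p2 (by positivity), Real.log_mul (by positivity) p1.ne',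
      Real.log_exp]
    linarith

end Chart

/-! ### Quasisymmetry bounds the width away from `π / 2` -/

lemma det2_finite_infinite {v u : Fin 2 → ℝ} (h : det2 v u = 1) (s : ℝ) :
    det2 (u + s • v) v = -1 := by
  rw [det2_swap, det2_infinite_finite h]

lemma four_point_line {r : ℝ → ℝ} (hr : StrictMono r) {M : ℝ} (hM : 0 ≤ M)
    (hq : ∀ s h, 0 < h → r (s + h) - r s ≤ M * (r s - r (s - h)) ∧
      r s - r (s - h) ≤ M * (r (s + h) - r s)) (a b c : ℝ) :
    |(b - c) * (r b - r c)| ≤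
      2 * (1 + M) * (|(a - c) * (r a - r c)| + |(a - b) * (r a - r b)|) := by
  wlog hbc : b ≤ c generalizing b c
  · have := this c b (le_of_not_ge hbc)
    rwa [show (c - b) * (r c - r b) = (b - c) * (r b - r c) by ring, add_comm |_|] at this
  have hmono : ∀ s t, s ≤ t → r s ≤ r t := fun s t h => hr.monotone h
  have hpos : ∀ s t, 0 ≤ (s - t) * (r s - r t) := fun s t => by
    rcases le_total s t with h | h
    · exact mul_nonneg_of_nonpos_of_nonpos (by linarith) (by linarith [hmono _ _ h])
    · exact mul_nonneg (by linarith) (by linarith [hmono _ _ h])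
  rw [abs_of_nonneg (hpos _ _), abs_of_nonneg (hpos _ _), abs_of_nonneg (hpos _ _)]
  have hK : (a - c) * (r a - r c) + (a - b) * (r a - r b) ≤
      2 * (1 + M) * ((a - c) * (r a - r c) + (a - b) * (r a - r b)) := by
    nlinarith [hpos a c, hpos a b]
  have hrbc := hmono _ _ hbc
  rcases le_or_gt a b with hab | hab
  · refine le_trans ?_ hK
    nlinarith [hpos a b, hmono _ _ hab]
  rcases le_or_gt c a with hca | hca
  · refine le_trans ?_ hK
    nlinarith [hpos a c, hmono _ _ hca]
  have hr1 := hr hab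
  have hr2 := hr hca
  have hac : 0 ≤ M * ((a - c) * (r a - r c)) := mul_nonneg hM (hpos _ _)
  have hab' : 0 ≤ M * ((a - b) * (r a - r b)) := mul_nonneg hM (hpos _ _)
  rcases le_total (c - a) (a - b) with h | h
  · have h1 := (hq a (c - a) (by linarith)).1
    rw [add_sub_cancel] at h1
    have h2 : r b ≤ r (a - (c - a)) := hmono _ _ (by linarith)
    have h3 : r c - r b ≤ (1 + M) * (r a - r b) := by nlinarith
    have h4 : (c - b) * (r c - r b) ≤ (2 * (a - b)) * ((1 + M) * (r a - r b)) :=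
      mul_le_mul (by linarith) h3 (by linarith) (by linarith)
    nlinarith [hpos a c]
  · have h1 := (hq a (a - b) (by linarith)).2
    rw [sub_sub_cancel] at h1
    have h2 : r (a + (a - b)) ≤ r c := hmono _ _ (by linarith)
    have h3 : r c - r b ≤ (1 + M) * (r c - r a) := by nlinarith
    have h4 : (c - b) * (r c - r b) ≤ (2 * (c - a)) * ((1 + M) * (r c - r a)) :=
      mul_le_mul (by linarith) h3 (by linarith) (by linarith)
    nlinarith [hpos a b]

lemma four_point_graph {φ : RP1 → RP1} (hbij : Function.Bijective φ)
    (hor : OrientationPreserving φ) {N : ℝ} (hN : N ∈ upperBounds (crSet φ))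
    {v₁ v₂ v₃ v₄ w₁ w₂ w₃ w₄ : Fin 2 → ℝ} (h₁ : OnGraph φ v₁ w₁) (h₂ : OnGraph φ v₂ w₂)
    (h₃ : OnGraph φ v₃ w₃) (h₄ : OnGraph φ v₄ w₄) :
    |det2 v₁ v₂ * det2 w₁ w₂| * |det2 v₃ v₄ * det2 w₃ w₄| ≤
      2 * (1 + exp N) * (|det2 v₁ v₃ * det2 w₁ w₃| * |det2 v₂ v₄ * det2 w₂ w₄| +
        |det2 v₁ v₄ * det2 w₁ w₄| * |det2 v₂ v₃ * det2 w₂ w₃|) := by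
  have hE := (Real.exp_pos N).le
  obtain ⟨u, hu⟩ := exists_det2_eq_one h₁.1
  obtain ⟨x, hx⟩ := exists_det2_eq_one h₁.2.1
  obtain ⟨r, C⟩ := exists_graphChart hbij hor hu hx h₁
  obtain ⟨c₂, d₂, -, -, ⟨rfl, rfl⟩ | ⟨s₂, rfl, rfl⟩⟩ := C.cases h₂
  · simp only [det2_smul_right, det2_self, mul_zero, abs_zero, zero_mul]
    positivity
  obtain ⟨c₃, d₃, -, -, ⟨rfl, rfl⟩ | ⟨s₃, rfl, rfl⟩⟩ := C.cases h₃ <;>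
    obtain ⟨c₄, d₄, -, -, ⟨rfl, rfl⟩ | ⟨s₄, rfl, rfl⟩⟩ := C.cases h₄ <;>
    simp only [det2_smul_left, det2_smul_right, det2_self, det2_infinite_finite hu,
      det2_infinite_finite hx, det2_finite_infinite hu, det2_finite_infinite hx,
      det2_finite_finite hu, det2_finite_finite hx, mul_zero, abs_zero, zero_mul, mul_one,
      zero_add, add_zero, abs_mul, abs_neg, abs_one, le_refl]
  · nlinarith [show 0 ≤ |c₂| * |d₂| * (|c₃| * |c₄| * (|d₃| * |d₄|)) by positivity]
  · nlinarith [show 0 ≤ |c₂| * |d₂| * (|c₃| * |c₄| * (|d₃| * |d₄|)) by positivity]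
  · have key := four_point_line C.strictMono hE
      (fun s h hh => C.symmetric_ratio_le hN s hh) s₂ s₃ s₄
    have := mul_le_mul_of_nonneg_left key
      (show 0 ≤ |c₂| * |d₂| * |c₃| * |d₃| * |c₄| * |d₄| by positivity)
    simp only [abs_mul] at this
    linarith

/-- The form inequality satisfied by quadruples of vectors of `S` persists on its convex hull,
being linear in each of the four vectors. -/
lemma qform_four_point_convexHull {S : Set (Fin 4 → ℝ)} {K : ℝ}
    (hS : ∀ x₁ ∈ S, ∀ x₂ ∈ S, ∀ x₃ ∈ S, ∀ x₄ ∈ S, qform x₁ x₂ * qform x₃ x₄ ≤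
      K * (qform x₁ x₃ * qform x₂ x₄ + qform x₁ x₄ * qform x₂ x₃)) :
    ∀ x₁ ∈ convexHull ℝ S, ∀ x₂ ∈ convexHull ℝ S, ∀ x₃ ∈ convexHull ℝ S,
      ∀ x₄ ∈ convexHull ℝ S, qform x₁ x₂ * qform x₃ x₄ ≤
        K * (qform x₁ x₃ * qform x₂ x₄ + qform x₁ x₄ * qform x₂ x₃) := by
  have extend : ∀ f : (Fin 4 → ℝ) → ℝ, (∀ x y, f (x + y) = f x + f y) →
      (∀ (c : ℝ) x, f (c • x) = c * f x) → (∀ x ∈ S, f x ≤ 0) →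
      ∀ x ∈ convexHull ℝ S, f x ≤ 0 := fun f hadd hsmul hf =>
    convexHull_min hf (convex_halfSpace_le ⟨hadd, hsmul⟩ 0)
  simp only [← sub_nonpos (b := K * _)] at hS ⊢
  have e₁ : ∀ x₁ ∈ convexHull ℝ S, ∀ x₂ ∈ S, ∀ x₃ ∈ S, ∀ x₄ ∈ S, qform x₁ x₂ * qform x₃ x₄ -
      K * (qform x₁ x₃ * qform x₂ x₄ + qform x₁ x₄ * qform x₂ x₃) ≤ 0 :=
    fun x₁ h₁ x₂ h₂ x₃ h₃ x₄ h₄ => extend (fun y => qform y x₂ * qform x₃ x₄ -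
        K * (qform y x₃ * qform x₂ x₄ + qform y x₄ * qform x₂ x₃))
      (fun x y => by simp only [qform_add_left]; ring)
      (fun c x => by simp only [qform_smul_left]; ring)
      (fun y hy => hS y hy x₂ h₂ x₃ h₃ x₄ h₄) x₁ h₁
  have e₂ : ∀ x₁ ∈ convexHull ℝ S, ∀ x₂ ∈ convexHull ℝ S, ∀ x₃ ∈ S, ∀ x₄ ∈ S,
      qform x₁ x₂ * qform x₃ x₄ -
      K * (qform x₁ x₃ * qform x₂ x₄ + qform x₁ x₄ * qform x₂ x₃) ≤ 0 :=
    fun x₁ h₁ x₂ h₂ x₃ h₃ x₄ h₄ => extend (fun y => qform x₁ y * qform x₃ x₄ -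
        K * (qform x₁ x₃ * qform y x₄ + qform x₁ x₄ * qform y x₃))
      (fun x y => by simp only [qform_add_left, qform_add_right]; ring)
      (fun c x => by simp only [qform_smul_left, qform_smul_right]; ring)
      (fun y hy => e₁ x₁ h₁ y hy x₃ h₃ x₄ h₄) x₂ h₂
  have e₃ : ∀ x₁ ∈ convexHull ℝ S, ∀ x₂ ∈ convexHull ℝ S, ∀ x₃ ∈ convexHull ℝ S, ∀ x₄ ∈ S,
      qform x₁ x₂ * qform x₃ x₄ -
      K * (qform x₁ x₃ * qform x₂ x₄ + qform x₁ x₄ * qform x₂ x₃) ≤ 0 :=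
    fun x₁ h₁ x₂ h₂ x₃ h₃ x₄ h₄ => extend (fun y => qform x₁ x₂ * qform y x₄ -
        K * (qform x₁ y * qform x₂ x₄ + qform x₁ x₄ * qform x₂ y))
      (fun x y => by simp only [qform_add_left, qform_add_right]; ring)
      (fun c x => by simp only [qform_smul_left, qform_smul_right]; ring)
      (fun y hy => e₂ x₁ h₁ x₂ h₂ y hy x₄ h₄) x₃ h₃
  exact fun x₁ h₁ x₂ h₂ x₃ h₃ x₄ h₄ => extend (fun y => qform x₁ x₂ * qform x₃ y -
        K * (qform x₁ x₃ * qform x₂ y + qform x₁ y * qform x₂ x₃))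
      (fun x y => by simp only [qform_add_right]; ring)
      (fun c x => by simp only [qform_smul_right]; ring)
      (fun y hy => e₃ x₁ h₁ x₂ h₂ x₃ h₃ y hy) x₄ h₄

/-- The coherent lifts of the graph of a circle map determined by a chart. -/
def chartLifts (v u w x : Fin 2 → ℝ) (r : ℝ → ℝ) : Set (Fin 4 → ℝ) :=
  {y | ∃ c : ℝ, 0 < c ∧ (y = c • toBoundary v w ∨
    ∃ s : ℝ, y = c • toBoundary (u + s • v) (x + r s • w))}

section Chart

variable {φ : RP1 → RP1} {v u w x : Fin 2 → ℝ} {r : ℝ → ℝ}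

lemma GraphChart.eq_smul_of_mem_lifts (C : GraphChart φ v u w x r) {y : Fin 4 → ℝ}
    (hy : y ∈ lifts (grGraph φ)) : ∃ c : ℝ, c ≠ 0 ∧ (y = c • toBoundary v w ∨
      ∃ s : ℝ, y = c • toBoundary (u + s • v) (x + r s • w)) := by
  obtain ⟨a, b, hab, rfl⟩ := mem_lifts_grGraph_iff.1 hy
  obtain ⟨c, d, hc, hd, ⟨rfl, rfl⟩ | ⟨s, rfl, rfl⟩⟩ := C.cases hab
  · exact ⟨c * d, mul_ne_zero hc hd, .inl (by
      rw [toBoundary_smul_left, toBoundary_smul_right, smul_smul])⟩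
  · exact ⟨c * d, mul_ne_zero hc hd, .inr ⟨s, by
      rw [toBoundary_smul_left, toBoundary_smul_right, smul_smul]⟩⟩

lemma GraphChart.chartLifts_subset (C : GraphChart φ v u w x r) :
    chartLifts v u w x r ⊆ lifts (grGraph φ) := by
  rintro y ⟨c, hc, rfl | ⟨s, rfl⟩⟩
  · exact mem_lifts_grGraph_iff.2 ⟨c • v, w, by
      simpa using C.infinite.smul hc.ne' one_ne_zero, (toBoundary_smul_left _ _ _).symm⟩
  · exact mem_lifts_grGraph_iff.2 ⟨c • (u + s • v), _, by
      simpa only [one_smul] using (C.finite s).smul hc.ne' one_ne_zero,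
      (toBoundary_smul_left _ _ _).symm⟩

lemma GraphChart.qform_nonpos (C : GraphChart φ v u w x r) {y z : Fin 4 → ℝ}
    (hy : y ∈ chartLifts v u w x r) (hz : z ∈ chartLifts v u w x r) : qform y z ≤ 0 := by
  obtain ⟨c, hc, hy⟩ := hy
  obtain ⟨d, hd, hz⟩ := hz
  have hcd : 0 < c * d := mul_pos hc hd
  rcases hy with rfl | ⟨s, rfl⟩ <;> rcases hz with rfl | ⟨t, rfl⟩ <;>
    simp only [qform_smul_left, qform_smul_right, qform_toBoundary, det2_self,
      det2_infinite_finite C.det_dom, det2_infinite_finite C.det_cod,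
      det2_finite_infinite C.det_dom, det2_finite_infinite C.det_cod,
      det2_finite_finite C.det_dom, det2_finite_finite C.det_cod]
  · simp
  · nlinarith
  · nlinarith
  · have : 0 ≤ (s - t) * (r s - r t) := by
      rcases le_total s t with h | h
      · exact mul_nonneg_of_nonpos_of_nonpos (by linarith)
          (by linarith [C.strictMono.monotone h])
      · exact mul_nonneg (by linarith) (by linarith [C.strictMono.monotone h])
    nlinarith

/-- A linear functional without zeros on the graph has constant sign on coherent lifts. -/
lemma GraphChart.finite_pos (C : GraphChart φ v u w x r) {L : (Fin 4 → ℝ) →ₗ[ℝ] ℝ}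
    (hL : ∀ y ∈ lifts (grGraph φ), L y ≠ 0) (hpos : 0 < L (toBoundary v w)) (s : ℝ) :
    0 < L (toBoundary (u + s • v) (x + r s • w)) := by
  have hcont : Continuous r := C.strictMono.monotone.continuous_of_surjective C.surjective
  set D := L (toBoundary v w) with hD
  have hF : ∀ s, L (toBoundary (u + s • v) (x + r s • w)) = L (toBoundary u x) +
      r s * L (toBoundary u w) + s * L (toBoundary v x) + s * r s * D := by
    intro s
    simp only [toBoundary_add_left, toBoundary_add_right, toBoundary_smul_left,
      toBoundary_smul_right, map_add, map_smul, smul_eq_mul, hD]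
    ring
  have hne : ∀ s, L (toBoundary (u + s • v) (x + r s • w)) ≠ 0 := fun s =>
    hL _ (mem_lifts_grGraph_iff.2 ⟨_, _, C.finite s, rfl⟩)
  obtain ⟨t, ht⟩ : ∃ t, 0 < L (toBoundary (u + t • v) (x + r t • w)) := by
    set A := |L (toBoundary u x)| + |L (toBoundary u w)| + |L (toBoundary v x)| with hA
    have hA0 : 0 ≤ A := by positivity
    obtain ⟨t₀, ht₀⟩ := C.surjective (1 + 2 * A / D)
    refine ⟨max t₀ (1 + 2 * A / D), ?_⟩
    set t := max t₀ (1 + 2 * A / D)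
    have hq : 0 ≤ 2 * A / D := by positivity
    have h1 : 1 + 2 * A / D ≤ t := le_max_right _ _
    have h2 : 1 + 2 * A / D ≤ r t := ht₀ ▸ C.strictMono.monotone (le_max_left _ _)
    have h3 : 2 * A / D * D = 2 * A := div_mul_cancel₀ _ hpos.ne'
    have ht1 : 1 ≤ t := by linarith
    have hr1 : 1 ≤ r t := by linarith
    have q1 : (D + 2 * A) * r t ≤ t * D * r t :=
      mul_le_mul_of_nonneg_right (by nlinarith) (by linarith)
    have q2 : t * (D + 2 * A) ≤ t * (r t * D) :=
      mul_le_mul_of_nonneg_left (by nlinarith) (by linarith)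
    have i1 := neg_abs_le (L (toBoundary u x))
    have i2 : -(r t * |L (toBoundary u w)|) ≤ r t * L (toBoundary u w) := by
      nlinarith [neg_abs_le (L (toBoundary u w))]
    have i3 : -(t * |L (toBoundary v x)|) ≤ t * L (toBoundary v x) := by
      nlinarith [neg_abs_le (L (toBoundary v x))]
    have j1 : |L (toBoundary u x)| + r t * |L (toBoundary u w)| ≤ A * r t := by
      nlinarith [abs_nonneg (L (toBoundary u x)), abs_nonneg (L (toBoundary v x))]
    have j2 : t * |L (toBoundary v x)| ≤ A * t := by
      nlinarith [abs_nonneg (L (toBoundary u x)), abs_nonneg (L (toBoundary u w))]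
    have j3 : 0 < D * r t := by positivity
    have j4 : 0 < D * t := by positivity
    rw [hF]
    linarith
  rw [← not_le]
  intro hle
  have hc : Continuous fun s => L (toBoundary (u + s • v) (x + r s • w)) := by
    simp only [hF]
    fun_prop
  obtain ⟨a, ha⟩ := mem_range_of_exists_le_of_exists_ge hc ⟨s, hle⟩ ⟨t, ht.le⟩
  exact hne a ha

lemma GraphChart.convexHull_pos_subset (C : GraphChart φ v u w x r) {L : (Fin 4 → ℝ) →ₗ[ℝ] ℝ}
    (hL : ∀ y ∈ lifts (grGraph φ), L y ≠ 0) {y : Fin 4 → ℝ}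
    (hy : y ∈ convexHull ℝ {x | x ∈ lifts (grGraph φ) ∧ 0 < L x}) :
    ∃ (c : ℝ), ∃ z ∈ convexHull ℝ (chartLifts v u w x r), y = c • z := by
  have hinf := hL _ (mem_lifts_grGraph_iff.2 ⟨_, _, C.infinite, rfl⟩)
  rcases lt_or_gt_of_ne hinf with hneg | hpos
  · have hpos : 0 < (-L) (toBoundary v w) := by simpa using hneg
    have hL' : ∀ y ∈ lifts (grGraph φ), (-L) y ≠ 0 := fun y hy => by simpa using hL y hy
    refine ⟨-1, -y, ?_, by simp⟩
    have : -y ∈ convexHull ℝ (-{x | x ∈ lifts (grGraph φ) ∧ 0 < L x}) := by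
      rw [convexHull_neg]; simpa using hy
    refine convexHull_mono ?_ this
    rintro z ⟨hz, hz'⟩
    obtain ⟨c, hc, h | ⟨s, h⟩⟩ := C.eq_smul_of_mem_lifts hz
    · refine ⟨-c, ?_, .inl (by rw [neg_smul, ← h, neg_neg])⟩
      rw [h, map_smul, smul_eq_mul] at hz'
      nlinarith
    · refine ⟨-c, ?_, .inr ⟨s, by rw [neg_smul, ← h, neg_neg]⟩⟩
      rw [h, map_smul, smul_eq_mul] at hz'
      have := C.finite_pos hL' hpos s
      rw [LinearMap.neg_apply] at this
      nlinarith
  · refine ⟨1, y, convexHull_mono ?_ hy, (one_smul _ _).symm⟩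
    rintro z ⟨hz, hz'⟩
    obtain ⟨c, hc, rfl | ⟨s, rfl⟩⟩ := C.eq_smul_of_mem_lifts hz
    · rw [map_smul, smul_eq_mul] at hz'
      exact ⟨c, pos_of_mul_pos_left hz' hpos.le, .inl rfl⟩
    · rw [map_smul, smul_eq_mul] at hz'
      exact ⟨c, pos_of_mul_pos_left hz' (C.finite_pos hL hpos s).le, .inr ⟨s, rfl⟩⟩

end Chart

lemma exists_chart_infinity {φ : RP1 → RP1} (hbij : Function.Bijective φ)
    (hor : OrientationPreserving φ) : ∃ v u w x r, GraphChart φ v u w x r := by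
  have hv : (![1, 0] : Fin 2 → ℝ) ≠ 0 := by
    intro h; simpa using congrFun h 0
  obtain ⟨w, hw⟩ := exists_onGraph φ hv
  obtain ⟨u, hu⟩ := exists_det2_eq_one hv
  obtain ⟨x, hx⟩ := exists_det2_eq_one hw.2.1
  obtain ⟨r, C⟩ := exists_graphChart hbij hor hu hx hw
  exact ⟨_, _, _, _, _, C⟩

/-- Quasisymmetry forces a converse of the reversed Cauchy–Schwarz inequality on the hull. -/
lemma qform_mul_le_of_mem_projConvexHull {φ : RP1 → RP1} (hbij : Function.Bijective φ)
    (hor : OrientationPreserving φ) {N : ℝ} (hN : N ∈ upperBounds (crSet φ))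
    {a b : Fin 4 → ℝ} {ha : a ≠ 0} {hb : b ≠ 0} (haΓ : projPt a ha ∈ projConvexHull (grGraph φ))
    (hbΓ : projPt b hb ∈ projConvexHull (grGraph φ)) :
    qform a a * qform b b ≤ 4 * (1 + exp N) * qform a b ^ 2 := by
  obtain ⟨v, u, w, x, r, C⟩ := exists_chart_infinity hbij hor
  have hmem : ∀ (y : Fin 4 → ℝ) (hy : y ≠ 0), projPt y hy ∈ projConvexHull (grGraph φ) →
      ∃ (c : ℝ), ∃ z ∈ convexHull ℝ (chartLifts v u w x r), y = c • z := by
    rintro y hy ⟨L, hL, y', hy', e, hy''⟩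
    obtain ⟨a, rfl⟩ := (Projectivization.mk_eq_mk_iff' ℝ _ _ _ _).1 e.symm
    obtain ⟨c, z, hz, rfl⟩ := C.convexHull_pos_subset hL hy''
    exact ⟨a * c, z, hz, smul_smul _ _ _⟩
  obtain ⟨c, a, ha', rfl⟩ := hmem a ha haΓ
  obtain ⟨d, b, hb', rfl⟩ := hmem b hb hbΓ
  have key := qform_four_point_convexHull (S := chartLifts v u w x r) (K := 2 * (1 + exp N))
    (fun x₁ h₁ x₂ h₂ x₃ h₃ x₄ h₄ => by
      have e : ∀ y ∈ chartLifts v u w x r, ∀ z ∈ chartLifts v u w x r,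
          qform y z = -|qform y z| := fun y hy z hz => by
        rw [abs_of_nonpos (C.qform_nonpos hy hz), neg_neg]
      rw [e _ h₁ _ h₂, e _ h₃ _ h₄, e _ h₁ _ h₃, e _ h₂ _ h₄, e _ h₁ _ h₄, e _ h₂ _ h₃]
      obtain ⟨v₁, w₁, g₁, rfl⟩ := mem_lifts_grGraph_iff.1 (C.chartLifts_subset h₁)
      obtain ⟨v₂, w₂, g₂, rfl⟩ := mem_lifts_grGraph_iff.1 (C.chartLifts_subset h₂)
      obtain ⟨v₃, w₃, g₃, rfl⟩ := mem_lifts_grGraph_iff.1 (C.chartLifts_subset h₃)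
      obtain ⟨v₄, w₄, g₄, rfl⟩ := mem_lifts_grGraph_iff.1 (C.chartLifts_subset h₄)
      have := four_point_graph hbij hor hN g₁ g₂ g₃ g₄
      simp only [qform_toBoundary, abs_mul (-(1 / 2) : ℝ), neg_mul_neg]
      rw [show |(-(1 / 2) : ℝ)| = 1 / 2 by norm_num]
      linarith) a ha' a ha' b hb' b hb'
  simp only [qform_smul_left, qform_smul_right]
  nlinarith [mul_le_mul_of_nonneg_left key (show 0 ≤ (c * d) ^ 2 by positivity)]

/-- The lengths of the timelike geodesic segments contained in the convex hull of `Γ`. -/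
def segmentLengths (Γ : Set RP3) : Set ℝ :=
  {T : ℝ | 0 ≤ T ∧ T < π ∧ ∃ a b : Fin 4 → ℝ,
      qform a a = -1 ∧ qform b b = -1 ∧ qform a b = 0 ∧
      ∀ t ∈ Icc (0 : ℝ) T, ∃ h : (Real.cos t • a + Real.sin t • b) ≠ 0,
        projPt (Real.cos t • a + Real.sin t • b) h ∈ projConvexHull Γ}

lemma bddAbove_segmentLengths (Γ : Set RP3) : BddAbove (segmentLengths Γ) :=
  ⟨π, fun _ h => h.2.1.le⟩

lemma width_lt_pi_div_two {φ : RP1 → RP1} (hbij : Function.Bijective φ)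
    (hor : OrientationPreserving φ) (hφ : BddAbove (crSet φ)) :
    width (grGraph φ) < π / 2 := by
  obtain ⟨N, hN⟩ := hφ
  set K := 4 * (1 + exp N) with hK
  have hK0 : 0 < K := by positivity
  set δ := √(1 / K) with hδ
  have hδ0 : 0 < δ := by positivity
  refine lt_of_le_of_lt (Real.sSup_le ?_ (Real.arccos_nonneg δ))
    (Real.arccos_lt_pi_div_two.2 hδ0)
  rintro T ⟨hT0, hTπ, a, b, haa, hbb, hab, hseg⟩
  have hcos : ∀ t ∈ Icc (0 : ℝ) T, δ ≤ |cos t| := by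
    intro t ht
    obtain ⟨h0, m0⟩ := hseg 0 ⟨le_rfl, hT0⟩
    obtain ⟨h1, m1⟩ := hseg t ht
    have := qform_mul_le_of_mem_projConvexHull hbij hor hN m0 m1
    have hba : qform b a = 0 := by rw [qform_comm, hab]
    simp only [qform_add_left, qform_add_right, qform_smul_left, qform_smul_right, haa, hbb,
      hab, hba, cos_zero, sin_zero] at this
    rw [hδ, ← Real.sqrt_sq_eq_abs]
    apply Real.sqrt_le_sqrt
    rw [div_le_iff₀ hK0]
    nlinarith [sin_sq_add_cos_sq t]
  have hT2 : T < π / 2 := by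
    by_contra! h
    have := hcos (π / 2) ⟨by positivity, h⟩
    rw [cos_pi_div_two, abs_zero] at this
    linarith
  have := hcos T ⟨hT0, le_rfl⟩
  rw [abs_of_pos (cos_pos_of_mem_Ioo ⟨by linarith [pi_pos], hT2⟩)] at this
  rw [← Real.arccos_cos hT0 hTπ.le]
  exact Real.arccos_le_arccos this

/-! ### Timelike segments produced by symmetric quadruples -/

lemma smul_add_smul_mem_convexHull {E : Type*} [AddCommGroup E] [Module ℝ E] {S : Set E}
    (hS : ∀ c : ℝ, 0 < c → ∀ x ∈ S, c • x ∈ S) {x y : E} (hx : x ∈ convexHull ℝ S)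
    (hy : y ∈ convexHull ℝ S) {a b : ℝ} (ha : 0 ≤ a) (hb : 0 ≤ b) (hab : 0 < a + b) :
    a • x + b • y ∈ convexHull ℝ S := by
  have hz : (a / (a + b)) • x + (b / (a + b)) • y ∈ convexHull ℝ S :=
    convex_convexHull ℝ S hx hy (by positivity) (by positivity) (by field_simp)
  have hmem := Set.smul_mem_smul_set (a := a + b) hz
  rw [← convexHull_smul, smul_add, smul_smul, smul_smul, mul_div_cancel₀ _ hab.ne',
    mul_div_cancel₀ _ hab.ne'] at hmem
  refine convexHull_mono ?_ hmem
  rintro _ ⟨z, hz, rfl⟩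
  exact hS _ hab z hz

lemma GraphChart.arctan_mem_segmentLengths {φ : RP1 → RP1} {v u w x : Fin 2 → ℝ} {r : ℝ → ℝ}
    (C : GraphChart φ v u w x r) (hr0 : r 0 = 0) {h A B : ℝ} (hh : 0 < h) (hA : 0 < A)
    (hB : 0 < B) (hrA : r (-h) = -A ^ 2) (hrB : r h = B ^ 2) :
    arctan (|A - B| / (A + B)) ∈ segmentLengths (grGraph φ) := by
  have huv : det2 u v = -1 := by rw [det2_swap, C.det_dom]
  have hxw : det2 x w = -1 := by rw [det2_swap, C.det_cod]
  set L : (Fin 4 → ℝ) →ₗ[ℝ] ℝ := (-2 : ℝ) • qformLinear (toBoundary v w + toBoundary u x) with hL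
  have hLapp : ∀ a b, L (toBoundary a b) = det2 v a * det2 w b + det2 u a * det2 x b := by
    intro a b
    simp only [hL, qformLinear, LinearMap.smul_apply, LinearMap.coe_mk, AddHom.coe_mk,
      qform_add_left, qform_toBoundary, smul_eq_mul]
    ring
  have hLinf : L (toBoundary v w) = 1 := by
    rw [hLapp, det2_self, det2_self, huv, hxw]; ring
  have hLfin : ∀ s, 0 < L (toBoundary (u + s • v) (x + r s • w)) := by
    intro s
    have hs : 0 ≤ s * r s := by
      rcases le_total 0 s with h | h
      · exact mul_nonneg h (hr0 ▸ C.strictMono.monotone h)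
      · exact mul_nonneg_of_nonpos_of_nonpos h (hr0 ▸ C.strictMono.monotone h)
    have e : L (toBoundary (u + s • v) (x + r s • w)) = 1 + s * r s := by
      rw [hLapp, det2_infinite_finite C.det_dom, det2_infinite_finite C.det_cod]
      simp only [det2_add_right, det2_smul_right, det2_self, huv, hxw]
      ring
    rw [e]; linarith
  have hLne : ∀ y ∈ lifts (grGraph φ), L y ≠ 0 := by
    intro y hy
    obtain ⟨c, hc, rfl | ⟨s, rfl⟩⟩ := C.eq_smul_of_mem_lifts hy
    · rw [map_smul, hLinf]; simpa using hc
    · rw [map_smul]; exact mul_ne_zero hc (hLfin s).ne'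
  set S : Set (Fin 4 → ℝ) := {y | y ∈ lifts (grGraph φ) ∧ 0 < L y} with hS
  have hscale : ∀ c : ℝ, 0 < c → ∀ y ∈ S, c • y ∈ S := by
    rintro c hc y ⟨hy, hy'⟩
    refine ⟨?_, by rw [map_smul]; exact mul_pos hc hy'⟩
    obtain ⟨a, b, hab, rfl⟩ := mem_lifts_grGraph_iff.1 hy
    exact mem_lifts_grGraph_iff.2 ⟨c • a, b, by simpa using hab.smul hc.ne' one_ne_zero,
      (toBoundary_smul_left _ _ _).symm⟩
  have hinf : toBoundary v w ∈ convexHull ℝ S := subset_convexHull ℝ S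
    ⟨mem_lifts_grGraph_iff.2 ⟨_, _, C.infinite, rfl⟩, by rw [hLinf]; exact one_pos⟩
  have hfin : ∀ s, toBoundary (u + s • v) (x + r s • w) ∈ convexHull ℝ S := fun s =>
    subset_convexHull ℝ S ⟨mem_lifts_grGraph_iff.2 ⟨_, _, C.finite s, rfl⟩, hLfin s⟩
  have hzero : toBoundary u x ∈ convexHull ℝ S := by simpa [hr0] using hfin 0
  obtain ⟨ρ, hρ, hρ2⟩ : ∃ ρ : ℝ, 0 < ρ ∧ ρ ^ 2 = h * A * B :=
    ⟨√(h * A * B), by positivity, Real.sq_sqrt (by positivity)⟩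
  set I := ρ • toBoundary v w + ρ⁻¹ • toBoundary u x with hI
  set J := (h / ρ) • toBoundary v x - (h / ρ)⁻¹ • toBoundary u w with hJ
  have hImem : I ∈ convexHull ℝ S :=
    smul_add_smul_mem_convexHull hscale hinf hzero hρ.le (by positivity) (by positivity)
  have hYmem : (A + B) • I + (A - B) • J ∈ convexHull ℝ S := by
    have := smul_add_smul_mem_convexHull hscale (hfin h) (hfin (-h))
      (a := A / ρ) (b := B / ρ) (by positivity) (by positivity) (by positivity)
    convert this using 1
    rw [hI, hJ, hrA, hrB]
    simp only [toBoundary_add_left, toBoundary_add_right, toBoundary_smul_left,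
      toBoundary_smul_right]
    have k2 : (h / ρ)⁻¹ = A * B / ρ := by field_simp; linarith
    rw [k2]
    match_scalars
    · field_simp; rw [hρ2]; ring
    · field_simp
    · field_simp; ring
    · field_simp; ring
  have hII : qform I I = -1 := by
    rw [hI]
    simp only [qform_add_left, qform_add_right, qform_smul_left, qform_smul_right,
      qform_toBoundary, det2_self, C.det_dom, C.det_cod, huv, hxw]
    field_simp
    ring
  have hJJ : qform J J = -1 := by
    rw [hJ, sub_eq_add_neg, ← neg_smul]
    simp only [qform_add_left, qform_add_right, qform_smul_left, qform_smul_right,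
      qform_toBoundary, det2_self, C.det_dom, C.det_cod, huv, hxw]
    field_simp
    ring
  have hIJ : qform I J = 0 := by
    rw [hI, hJ, sub_eq_add_neg, ← neg_smul]
    simp only [qform_add_left, qform_add_right, qform_smul_left, qform_smul_right,
      qform_toBoundary, det2_self]
    ring
  obtain ⟨ε, hε, hεm⟩ : ∃ ε : ℝ, ε ^ 2 = 1 ∧ A - B = ε * |A - B| := by
    rcases le_total 0 (A - B) with h | h
    · exact ⟨1, by norm_num, by rw [abs_of_nonneg h, one_mul]⟩
    · exact ⟨-1, by norm_num, by rw [abs_of_nonpos h]; ring⟩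
  set m := |A - B| with hm
  have hm0 : 0 ≤ m := abs_nonneg _
  have hAB : 0 < A + B := by positivity
  refine ⟨Real.arctan_nonneg.2 (by positivity),
    (Real.arctan_lt_pi_div_two _).trans (by linarith [pi_pos]), I, ε • J, hII, ?_, ?_, ?_⟩
  · rw [qform_smul_left, qform_smul_right, hJJ]; linear_combination -hε
  · rw [qform_smul_right, hIJ, mul_zero]
  rintro t ⟨ht0, htT⟩
  have htlt : t < π / 2 := htT.trans_lt (Real.arctan_lt_pi_div_two _)
  have hcos : 0 < cos t := cos_pos_of_mem_Ioo ⟨by linarith [pi_pos], htlt⟩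
  have hsin : 0 ≤ sin t := sin_nonneg_of_nonneg_of_le_pi ht0 (by linarith [pi_pos])
  have htan : sin t * (A + B) ≤ m * cos t := by
    have : tan t ≤ m / (A + B) := by
      rw [← Real.tan_arctan (m / (A + B))]
      exact Real.strictMonoOn_tan.monotoneOn ⟨by linarith [pi_pos], htlt⟩
        ⟨Real.neg_pi_div_two_lt_arctan _, Real.arctan_lt_pi_div_two _⟩ htT
    rwa [tan_eq_sin_div_cos, div_le_div_iff₀ hcos hAB] at this
  have hne : cos t • I + sin t • ε • J ≠ 0 := by
    intro h0
    have : qform (cos t • I + sin t • ε • J) (cos t • I + sin t • ε • J) = -1 := by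
      have hJI : qform J I = 0 := by rw [qform_comm, hIJ]
      simp only [qform_add_left, qform_add_right, qform_smul_left, qform_smul_right, hII, hJJ,
        hIJ, hJI]
      linear_combination -(sin t) ^ 2 * hε - sin_sq_add_cos_sq t
    rw [h0] at this
    simp [qform] at this
  refine ⟨hne, L, hLne, _, hne, rfl, ?_⟩
  rcases hm0.eq_or_lt with h0 | hmpos
  · have hs : sin t = 0 := by nlinarith
    rw [hs, zero_smul, add_zero]
    simpa using smul_add_smul_mem_convexHull hscale hImem hImem hcos.le le_rfl (by simpa)
  · have key := smul_add_smul_mem_convexHull hscale hImem hYmem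
      (a := cos t - sin t * (A + B) / m) (b := sin t / m)
      (sub_nonneg.2 (by rw [div_le_iff₀ hmpos]; linarith)) (by positivity) (by
        rcases hsin.eq_or_lt with hs | hs
        · rw [← hs]; simpa using hcos
        · exact add_pos_of_nonneg_of_pos
            (sub_nonneg.2 (by rw [div_le_iff₀ hmpos]; linarith)) (by positivity))
    convert key using 1
    rw [hεm]
    clear_value I J
    match_scalars
    · field_simp; ring
    · field_simp

lemma tanh_abs_log_div_four {A B : ℝ} (hA : 0 < A) (hB : 0 < B) :
    tanh (|log (A ^ 2 / B ^ 2)| / 4) = |A - B| / (A + B) := by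
  wlog h : B ≤ A generalizing A B
  · have := this hB hA (le_of_not_ge h)
    rwa [← inv_div (A ^ 2) (B ^ 2), Real.log_inv, abs_neg, abs_sub_comm, add_comm B A] at this
  have h1 : 1 ≤ A / B := (one_le_div hB).2 h
  have hlog : |log (A ^ 2 / B ^ 2)| / 4 = log (A / B) / 2 := by
    rw [← div_pow, Real.log_pow, abs_of_nonneg (mul_nonneg (by norm_num) (Real.log_nonneg h1))]
    push_cast
    ring
  have he : exp (log (A / B) / 2) * exp (log (A / B) / 2) = A / B := by
    rw [← Real.exp_add, add_halves, Real.exp_log (by positivity)]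
  rw [hlog, abs_of_nonneg (by linarith), Real.tanh_eq_sinh_div_cosh, Real.sinh_eq, Real.cosh_eq,
    Real.exp_neg]
  have hp := Real.exp_pos (log (A / B) / 2)
  set y := exp (log (A / B) / 2)
  have hA' : A = y * y * B := by rw [he]; field_simp
  rw [hA']
  field_simp

lemma exists_eq_mk_finite {v u : Fin 2 → ℝ} (h : det2 v u = 1) {hv : v ≠ 0} {p : RP1}
    (hp : p ≠ .mk ℝ v hv) : ∃ (s : ℝ) (hs : u + s • v ≠ 0), p = .mk ℝ (u + s • v) hs := by
  induction p using Projectivization.ind with | h y hy =>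
  have hd : det2 v y ≠ 0 := fun h0 => hp ((mk_eq_mk_iff_det2 hv hy).2 h0).symm
  obtain ⟨c, s, hc, rfl⟩ := exists_eq_smul_finite h hd
  refine ⟨s, right_ne_zero_of_smul hy, ?_⟩
  rw [mk_eq_mk_iff_det2, det2_smul_left, det2_self, mul_zero]

lemma ne_of_crossRatio_eq_neg_one {z₁ z₂ z₃ z₄ : RP1} (h : crossRatio z₁ z₂ z₃ z₄ = -1) :
    z₂ ≠ z₁ ∧ z₃ ≠ z₁ ∧ z₄ ≠ z₁ := by
  refine ⟨?_, ?_, ?_⟩ <;> rintro rfl <;> rw [crossRatio] at h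
  · simp [det2_self] at h
  · rw [det2_swap z₃.rep z₂.rep, det2_swap z₃.rep z₄.rep, mul_neg, mul_neg, neg_div_neg_eq,
      mul_comm] at h
    by_cases h0 : det2 z₂.rep z₃.rep * det2 z₄.rep z₃.rep = 0
    · rw [h0] at h; norm_num at h
    · rw [div_self h0] at h; norm_num at h
  · simp [det2_self] at h

lemma tanh_mem_tan_segmentLengths {φ : RP1 → RP1} (hbij : Function.Bijective φ)
    (hor : OrientationPreserving φ) {ℓ : ℝ} (hℓ : ℓ ∈ crSet φ) :
    ∃ T ∈ segmentLengths (grGraph φ), tan T = tanh (ℓ / 4) := by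
  obtain ⟨z₁, z₂, z₃, z₄, hcr, rfl⟩ := hℓ
  obtain ⟨h21, h31, h41⟩ := ne_of_crossRatio_eq_neg_one hcr
  have hφ31 : φ z₃ ≠ φ z₁ := fun e => h31 (hbij.1 e)
  induction z₁ using Projectivization.ind with | h v hv =>
  obtain ⟨u₀, hu₀⟩ := exists_det2_eq_one hv
  obtain ⟨s₃, hu, rfl⟩ := exists_eq_mk_finite hu₀ h31
  have hvu := det2_infinite_finite hu₀ s₃
  set u := u₀ + s₃ • v
  obtain ⟨w, hw, ew⟩ : ∃ w, ∃ hw : w ≠ 0, φ (.mk ℝ v hv) = .mk ℝ w hw :=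
    ⟨_, _, (Projectivization.mk_rep _).symm⟩
  rw [ew] at hφ31
  obtain ⟨x₀, hx₀⟩ := exists_det2_eq_one hw
  obtain ⟨y₃, hx, ex⟩ := exists_eq_mk_finite hx₀ hφ31
  have hwx := det2_infinite_finite hx₀ y₃
  set x := x₀ + y₃ • w
  obtain ⟨r, C⟩ := exists_graphChart hbij hor hvu hwx ⟨hv, hw, ew⟩
  have hr0 : r 0 = 0 := by
    have := (C.finite 0).det2_eq_zero ⟨hu, hx, ex⟩ (by simp [det2_self])
    rw [det2_add_left, det2_self, det2_smul_left, hwx] at this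
    linarith
  obtain ⟨a, ha, rfl⟩ := exists_eq_mk_finite hvu h21
  obtain ⟨b, hb, rfl⟩ := exists_eq_mk_finite hvu h41
  obtain ⟨_, hwa, ea⟩ := C.finite a
  obtain ⟨_, hwb, eb⟩ := C.finite b
  have hcr' := crossRatio_chart hvu hv ha (b := 0) (by simpa using hu) hb
  have hcrφ := crossRatio_chart hwx hw hwa (b := 0) (by simpa using hx) hwb
  simp only [zero_smul, add_zero, zero_sub, neg_div_neg_eq] at hcr' hcrφ
  rw [hcr'] at hcr
  have hb0 : b ≠ 0 := by rintro rfl; simp at hcr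
  have hab : a = -b := by rw [div_eq_iff hb0] at hcr; linarith
  subst hab
  rw [ew, ex, ea, eb, hcrφ]
  have main : ∀ h : ℝ, 0 < h → ∃ T ∈ segmentLengths (grGraph φ),
      tan T = tanh (|log (abs (r (-h) / r h))| / 4) := by
    intro h hh
    have h1 : 0 < r h := hr0 ▸ C.strictMono hh
    have h2 : 0 < -r (-h) := neg_pos.2 (hr0 ▸ C.strictMono (neg_neg_of_pos hh))
    refine ⟨_, C.arctan_mem_segmentLengths hr0 hh (Real.sqrt_pos.2 h2) (Real.sqrt_pos.2 h1)
      (by rw [Real.sq_sqrt h2.le, neg_neg]) (by rw [Real.sq_sqrt h1.le]), ?_⟩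
    rw [Real.tan_arctan, ← tanh_abs_log_div_four (Real.sqrt_pos.2 h2) (Real.sqrt_pos.2 h1),
      Real.sq_sqrt h2.le, Real.sq_sqrt h1.le, abs_div, abs_of_pos h1, ← abs_neg (r (-h)),
      abs_of_pos h2]
  rcases lt_or_gt_of_ne hb0 with hneg | hpos
  · obtain ⟨T, hT, e⟩ := main (-b) (by linarith)
    refine ⟨T, hT, e.trans ?_⟩
    rw [neg_neg, ← inv_div (r (-b)) (r b), abs_inv, Real.log_inv, abs_neg]
  · exact main b hpos

/-- **Proposition (width bounded below by cross-ratio norm).** Given any quasisymmetric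
homeomorphism `φ` of `ℝP¹`, if `w` is the width of the convex hull of the graph of `φ` in
`∂∞AdS³`, then `tanh(‖φ‖_cr / 4) ≤ tan w`. -/
theorem tanh_crNorm_le_tan_width (φ : RP1 ≃ₜ RP1) (hφ : Quasisymmetric φ) :
    Real.tanh (crNorm ⇑φ / 4) ≤ Real.tan (width (grGraph ⇑φ)) := by
  obtain ⟨hor, hbdd⟩ := hφ
  have hw := width_lt_pi_div_two φ.bijective hor hbdd
  have hw0 : 0 ≤ width (grGraph ⇑φ) := Real.sSup_nonneg fun T hT => hT.1
  have hle : ∀ ℓ ∈ crSet ⇑φ, tanh (ℓ / 4) ≤ tan (width (grGraph ⇑φ)) := by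
    intro ℓ hℓ
    obtain ⟨T, hT, e⟩ := tanh_mem_tan_segmentLengths φ.bijective hor hℓ
    rw [← e]
    have hTw : T ≤ width (grGraph ⇑φ) := le_csSup (bddAbove_segmentLengths _) hT
    exact Real.strictMonoOn_tan.monotoneOn ⟨by linarith [hT.1, pi_pos], by linarith⟩
      ⟨by linarith [pi_pos], hw⟩ hTw
  rcases (crSet ⇑φ).eq_empty_or_nonempty with h | hne
  · rw [crNorm, h, Real.sSup_empty, zero_div, Real.tanh_zero]
    exact Real.tan_nonneg_of_nonneg_of_le_pi_div_two hw0 hw.le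
  · have hcont : Continuous fun ℓ : ℝ => tanh (ℓ / 4) := by
      simp only [Real.tanh_eq_sinh_div_cosh]
      exact (by fun_prop : Continuous fun ℓ : ℝ => sinh (ℓ / 4)).div (by fun_prop)
        fun ℓ => (Real.cosh_pos _).ne'
    exact closure_minimal (s := crSet ⇑φ)
      (t := {ℓ | tanh (ℓ / 4) ≤ tan (width (grGraph ⇑φ))}) hle
      (isClosed_le hcont continuous_const) (csSup_mem_closure hne hbdd)

end AdSPaper
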